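/- arXiv:1612.01063 — 8 statements merged into one kernel-verified Lean document; each statement's English description precedes it below -/
import Mathlib

section
/- Let m₁, m₂ be positive real numbers and let θ ∈ (0, π/2). Then (2m₁+m₂)·(1 − cot²θ) + m₂·(1 − tan²θ) + 4m₂ = 0 holds if and only if cot²θ = (m₁+3m₂+√(m₁²+4m₁m₂+8m₂²))/(2m₁+m₂) or cot²θ = (m₁+3m₂−√(m₁²+4m₁m₂+8m₂²))/(2m₁+m₂). Both of these two values are positive and distinct, and no θ satisfying the equation satisfies (2m₁+m₂)·cot²θ = m₂. -/
open Real

/-- With `x = cot²θ` and `x⁻¹ = tan²θ`, clearing the denominator of the biharmonicity condition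
leaves a quadratic equation, written here with its square completed. -/
lemma biharmonic_iff_sq_eq {m₁ m₂ x : ℝ} (ha : 2 * m₁ + m₂ ≠ 0) (hx : x ≠ 0) :
    (2 * m₁ + m₂) * (1 - x) + m₂ * (1 - x⁻¹) + 4 * m₂ = 0 ↔
      ((2 * m₁ + m₂) * x - (m₁ + 3 * m₂)) ^ 2 = m₁ ^ 2 + 4 * m₁ * m₂ + 8 * m₂ ^ 2 := by
  have key : ((2 * m₁ + m₂) * x - (m₁ + 3 * m₂)) ^ 2 - (m₁ ^ 2 + 4 * m₁ * m₂ + 8 * m₂ ^ 2) =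
      -((2 * m₁ + m₂) * x) * ((2 * m₁ + m₂) * (1 - x) + m₂ * (1 - x⁻¹) + 4 * m₂) := by
    field_simp
    ring
  rw [← sub_eq_zero (b := m₁ ^ 2 + 4 * m₁ * m₂ + 8 * m₂ ^ 2), key, mul_eq_zero,
    or_iff_right (neg_ne_zero.mpr (mul_ne_zero ha hx))]

lemma Real.cot_pos_of_pos_of_lt_pi_div_two {θ : ℝ} (h0 : 0 < θ) (h1 : θ < π / 2) :
    0 < Real.cot θ := by
  rw [← Real.tan_inv_eq_cot]
  exact inv_pos.mpr (Real.tan_pos_of_pos_of_lt_pi_div_two h0 h1)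

/-- Type B₂/C₂ isotropy actions, edge `P₀^{α₂,δ}`: the biharmonicity condition
`(2m₁+m₂)(1 − cot²θ) + m₂(1 − tan²θ) + 4m₂ = 0` for `θ ∈ (0, π/2)` holds iff
`cot²θ` equals one of the two values `(m₁+3m₂ ± √(m₁²+4m₁m₂+8m₂²))/(2m₁+m₂)`;
these two values are positive and distinct, and no solution is harmonic, i.e.
satisfies `(2m₁+m₂)cot²θ = m₂`. -/
theorem stmt_4 (m₁ m₂ : ℝ) (hm₁ : 0 < m₁) (hm₂ : 0 < m₂) :
    (∀ θ : ℝ, 0 < θ → θ < π / 2 →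
      ((2 * m₁ + m₂) * (1 - Real.cot θ ^ 2) + m₂ * (1 - Real.tan θ ^ 2) + 4 * m₂ = 0 ↔
        Real.cot θ ^ 2 =
          (m₁ + 3 * m₂ + Real.sqrt (m₁ ^ 2 + 4 * m₁ * m₂ + 8 * m₂ ^ 2)) / (2 * m₁ + m₂) ∨
        Real.cot θ ^ 2 =
          (m₁ + 3 * m₂ - Real.sqrt (m₁ ^ 2 + 4 * m₁ * m₂ + 8 * m₂ ^ 2)) / (2 * m₁ + m₂))) ∧
    0 < (m₁ + 3 * m₂ + Real.sqrt (m₁ ^ 2 + 4 * m₁ * m₂ + 8 * m₂ ^ 2)) / (2 * m₁ + m₂) ∧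
    0 < (m₁ + 3 * m₂ - Real.sqrt (m₁ ^ 2 + 4 * m₁ * m₂ + 8 * m₂ ^ 2)) / (2 * m₁ + m₂) ∧
    (m₁ + 3 * m₂ + Real.sqrt (m₁ ^ 2 + 4 * m₁ * m₂ + 8 * m₂ ^ 2)) / (2 * m₁ + m₂) ≠
      (m₁ + 3 * m₂ - Real.sqrt (m₁ ^ 2 + 4 * m₁ * m₂ + 8 * m₂ ^ 2)) / (2 * m₁ + m₂) ∧
    (∀ θ : ℝ, 0 < θ → θ < π / 2 →
      (2 * m₁ + m₂) * (1 - Real.cot θ ^ 2) + m₂ * (1 - Real.tan θ ^ 2) + 4 * m₂ = 0 →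
      (2 * m₁ + m₂) * Real.cot θ ^ 2 ≠ m₂) := by
  have ha : 0 < 2 * m₁ + m₂ := by positivity
  have hD : 0 < m₁ ^ 2 + 4 * m₁ * m₂ + 8 * m₂ ^ 2 := by positivity
  have hs := Real.sqrt_pos.mpr hD
  have hlt : Real.sqrt (m₁ ^ 2 + 4 * m₁ * m₂ + 8 * m₂ ^ 2) < m₁ + 3 * m₂ := by
    rw [Real.sqrt_lt' (by positivity)]
    nlinarith [mul_pos hm₁ hm₂, mul_pos hm₂ hm₂]
  have htan (θ : ℝ) : Real.tan θ ^ 2 = (Real.cot θ ^ 2)⁻¹ := by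
    rw [← Real.tan_inv_eq_cot, inv_pow, inv_inv]
  refine ⟨fun θ h0 h1 => ?_, by positivity, div_pos (sub_pos.mpr hlt) ha, ?_,
    fun θ h0 h1 h hharm => ?_⟩
  · have hx := pow_pos (Real.cot_pos_of_pos_of_lt_pi_div_two h0 h1) 2
    rw [htan, biharmonic_iff_sq_eq ha.ne' hx.ne', eq_div_iff ha.ne', eq_div_iff ha.ne',
      ← Real.sq_sqrt hD.le, sq_eq_sq_iff_eq_or_eq_neg, Real.sq_sqrt hD.le]
    refine or_congr ?_ ?_ <;> constructor <;> intro h <;> linarith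
  · rw [Ne, div_left_inj' ha.ne']
    linarith
  · have hx := pow_pos (Real.cot_pos_of_pos_of_lt_pi_div_two h0 h1) 2
    rw [htan, biharmonic_iff_sq_eq ha.ne' hx.ne', hharm] at h
    nlinarith [mul_pos hm₁ hm₂, mul_pos hm₂ hm₂]
end

section
/- Let m₁, m₂ be positive real numbers and let w be a positive real number. Then 4m₂ + m₂·(1 − w) + (2m₁+m₂)·(1 − 1/w) = 0 holds if and only if w = (m₁+3m₂+√(m₁²+4m₁m₂+8m₂²))/m₂ or w = (m₁+3m₂−√(m₁²+4m₁m₂+8m₂²))/m₂. Both of these values are positive and distinct, and neither equals (2m₁+m₂)/m₂. -/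
/-- Type B₂/C₂ isotropy actions, edge `P₀^{α₁,α₂}`: for positive `w` (standing for
`cot²(⟨α₁,H⟩/2)`), the biharmonicity condition
`4m₂ + m₂(1 − w) + (2m₁+m₂)(1 − 1/w) = 0` holds iff
`w = (m₁+3m₂ ± √(m₁²+4m₁m₂+8m₂²))/m₂`; both values are positive and distinct,
and neither equals the harmonicity value `(2m₁+m₂)/m₂`. -/
theorem stmt_5 (m₁ m₂ : ℝ) (hm₁ : 0 < m₁) (hm₂ : 0 < m₂) :
    (∀ w : ℝ, 0 < w →
      (4 * m₂ + m₂ * (1 - w) + (2 * m₁ + m₂) * (1 - 1 / w) = 0 ↔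
        w = (m₁ + 3 * m₂ + Real.sqrt (m₁ ^ 2 + 4 * m₁ * m₂ + 8 * m₂ ^ 2)) / m₂ ∨
        w = (m₁ + 3 * m₂ - Real.sqrt (m₁ ^ 2 + 4 * m₁ * m₂ + 8 * m₂ ^ 2)) / m₂)) ∧
    0 < (m₁ + 3 * m₂ + Real.sqrt (m₁ ^ 2 + 4 * m₁ * m₂ + 8 * m₂ ^ 2)) / m₂ ∧
    0 < (m₁ + 3 * m₂ - Real.sqrt (m₁ ^ 2 + 4 * m₁ * m₂ + 8 * m₂ ^ 2)) / m₂ ∧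
    (m₁ + 3 * m₂ + Real.sqrt (m₁ ^ 2 + 4 * m₁ * m₂ + 8 * m₂ ^ 2)) / m₂ ≠
      (m₁ + 3 * m₂ - Real.sqrt (m₁ ^ 2 + 4 * m₁ * m₂ + 8 * m₂ ^ 2)) / m₂ ∧
    (m₁ + 3 * m₂ + Real.sqrt (m₁ ^ 2 + 4 * m₁ * m₂ + 8 * m₂ ^ 2)) / m₂ ≠
      (2 * m₁ + m₂) / m₂ ∧
    (m₁ + 3 * m₂ - Real.sqrt (m₁ ^ 2 + 4 * m₁ * m₂ + 8 * m₂ ^ 2)) / m₂ ≠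
      (2 * m₁ + m₂) / m₂ := by
  have hs2 : Real.sqrt (m₁ ^ 2 + 4 * m₁ * m₂ + 8 * m₂ ^ 2) ^ 2
      = m₁ ^ 2 + 4 * m₁ * m₂ + 8 * m₂ ^ 2 := Real.sq_sqrt (by positivity)
  have hs : 0 < Real.sqrt (m₁ ^ 2 + 4 * m₁ * m₂ + 8 * m₂ ^ 2) :=
    Real.sqrt_pos.mpr (by positivity)
  generalize Real.sqrt (m₁ ^ 2 + 4 * m₁ * m₂ + 8 * m₂ ^ 2) = s at hs2 hs ⊢
  have hm : 0 < m₁ * m₂ := mul_pos hm₁ hm₂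
  have hm₂sq : 0 < m₂ ^ 2 := by positivity
  refine ⟨fun w hw => ?_, by positivity, div_pos ?_ hm₂, fun h => ?_, fun h => ?_, fun h => ?_⟩
  · have key : w * (4 * m₂ + m₂ * (1 - w) + (2 * m₁ + m₂) * (1 - 1 / w)) * m₂
        = -((w * m₂ - (m₁ + 3 * m₂ + s)) * (w * m₂ - (m₁ + 3 * m₂ - s))) := by
      field_simp
      linear_combination -hs2
    rw [eq_div_iff hm₂.ne', eq_div_iff hm₂.ne', ← sub_eq_zero (a := w * m₂),
      ← sub_eq_zero (a := w * m₂) (b := m₁ + 3 * m₂ - s), ← mul_eq_zero, ← neg_eq_zero (a := (w * m₂ - _) * _), ← key]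
    simp [hw.ne', hm₂.ne']
  · have : s < m₁ + 3 * m₂ := lt_of_pow_lt_pow_left₀ 2 (by positivity) (by nlinarith)
    linarith
  · rw [div_left_inj' hm₂.ne'] at h
    linarith
  · rw [div_left_inj' hm₂.ne'] at h
    have : s = m₁ - 2 * m₂ := by linarith
    rw [this] at hs2
    nlinarith
  · rw [div_left_inj' hm₂.ne'] at h
    have : s = 2 * m₂ - m₁ := by linarith
    rw [this] at hs2
    nlinarith
end

section
/- Let m₁, m₂, m₃ be positive real numbers and let θ ∈ (0, π/2). Then (m₁+2m₂+m₃)·(1 − cot²θ) + m₃·(1 − tan²θ) + 4m₃ = 0 holds if and only if cot²θ = (m₁+2m₂+6m₃ ± √((m₁+2m₂+6m₃)² − 4(m₁+2m₂+m₃)m₃))/(2(m₁+2m₂+m₃)) (for one of the two signs). The discriminant (m₁+2m₂+6m₃)² − 4(m₁+2m₂+m₃)m₃ is positive, the two values are positive and distinct, and no θ satisfying the equation satisfies (m₁+2m₂+m₃)·cot²θ = m₃. -/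
open Real

lemma Real.cot_sq_pos_of_pos_of_lt_pi_div_two {θ : ℝ} (h₀ : 0 < θ) (h₁ : θ < π / 2) :
    0 < Real.cot θ ^ 2 := by
  rw [← Real.tan_inv_eq_cot]
  have := Real.tan_pos_of_pos_of_lt_pi_div_two h₀ h₁
  positivity

/-- The biharmonicity condition in the variable `x = cot² θ` is a quadratic equation. -/
lemma biharmonic_iff_quadratic (A c : ℝ) {θ : ℝ} (h₀ : 0 < θ) (h₁ : θ < π / 2) :
    A * (1 - Real.cot θ ^ 2) + c * (1 - Real.tan θ ^ 2) + 4 * c = 0 ↔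
      A * (Real.cot θ ^ 2 * Real.cot θ ^ 2) + -(A + 5 * c) * Real.cot θ ^ 2 + c = 0 := by
  have hx := Real.cot_sq_pos_of_pos_of_lt_pi_div_two h₀ h₁
  have htan : Real.tan θ ^ 2 = (Real.cot θ ^ 2)⁻¹ := by
    rw [← Real.tan_inv_eq_cot, inv_pow, inv_inv]
  rw [htan]
  generalize Real.cot θ ^ 2 = x at hx
  have key : A * (x * x) + -(A + 5 * c) * x + c =
      -x * (A * (1 - x) + c * (1 - x⁻¹) + 4 * c) := by
    field_simp
    ring
  rw [key, mul_eq_zero, or_iff_right (neg_ne_zero.mpr hx.ne')]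

/-- Type BC₂ isotropy actions, edge `P₀^{α₁,δ}`: the biharmonicity condition
`(m₁+2m₂+m₃)(1 − cot²θ) + m₃(1 − tan²θ) + 4m₃ = 0` for `θ ∈ (0, π/2)` holds iff
`cot²θ = (m₁+2m₂+6m₃ ± √((m₁+2m₂+6m₃)² − 4(m₁+2m₂+m₃)m₃))/(2(m₁+2m₂+m₃))`; the
discriminant is positive, the two values are positive and distinct, and no solution
satisfies the harmonicity condition `(m₁+2m₂+m₃)cot²θ = m₃`. -/
theorem stmt_6 (m₁ m₂ m₃ : ℝ) (hm₁ : 0 < m₁) (hm₂ : 0 < m₂) (hm₃ : 0 < m₃) :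
    (∀ θ : ℝ, 0 < θ → θ < π / 2 →
      ((m₁ + 2 * m₂ + m₃) * (1 - Real.cot θ ^ 2) + m₃ * (1 - Real.tan θ ^ 2) + 4 * m₃ = 0 ↔
        Real.cot θ ^ 2 =
          (m₁ + 2 * m₂ + 6 * m₃ +
            Real.sqrt ((m₁ + 2 * m₂ + 6 * m₃) ^ 2 - 4 * (m₁ + 2 * m₂ + m₃) * m₃)) /
            (2 * (m₁ + 2 * m₂ + m₃)) ∨
        Real.cot θ ^ 2 =
          (m₁ + 2 * m₂ + 6 * m₃ -
            Real.sqrt ((m₁ + 2 * m₂ + 6 * m₃) ^ 2 - 4 * (m₁ + 2 * m₂ + m₃) * m₃)) /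
            (2 * (m₁ + 2 * m₂ + m₃)))) ∧
    0 < (m₁ + 2 * m₂ + 6 * m₃) ^ 2 - 4 * (m₁ + 2 * m₂ + m₃) * m₃ ∧
    0 < (m₁ + 2 * m₂ + 6 * m₃ +
          Real.sqrt ((m₁ + 2 * m₂ + 6 * m₃) ^ 2 - 4 * (m₁ + 2 * m₂ + m₃) * m₃)) /
          (2 * (m₁ + 2 * m₂ + m₃)) ∧
    0 < (m₁ + 2 * m₂ + 6 * m₃ -
          Real.sqrt ((m₁ + 2 * m₂ + 6 * m₃) ^ 2 - 4 * (m₁ + 2 * m₂ + m₃) * m₃)) /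
          (2 * (m₁ + 2 * m₂ + m₃)) ∧
    (m₁ + 2 * m₂ + 6 * m₃ +
        Real.sqrt ((m₁ + 2 * m₂ + 6 * m₃) ^ 2 - 4 * (m₁ + 2 * m₂ + m₃) * m₃)) /
        (2 * (m₁ + 2 * m₂ + m₃)) ≠
      (m₁ + 2 * m₂ + 6 * m₃ -
        Real.sqrt ((m₁ + 2 * m₂ + 6 * m₃) ^ 2 - 4 * (m₁ + 2 * m₂ + m₃) * m₃)) /
        (2 * (m₁ + 2 * m₂ + m₃)) ∧
    (∀ θ : ℝ, 0 < θ → θ < π / 2 →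
      (m₁ + 2 * m₂ + m₃) * (1 - Real.cot θ ^ 2) + m₃ * (1 - Real.tan θ ^ 2) + 4 * m₃ = 0 →
      (m₁ + 2 * m₂ + m₃) * Real.cot θ ^ 2 ≠ m₃) := by
  obtain ⟨A, hA⟩ : ∃ A, A = m₁ + 2 * m₂ + m₃ := ⟨_, rfl⟩
  have hB : m₁ + 2 * m₂ + 6 * m₃ = A + 5 * m₃ := by rw [hA]; ring
  have hApos : 0 < A := by rw [hA]; positivity
  rw [← hA, hB]
  have hAc : 0 < A * m₃ := mul_pos hApos hm₃
  have hD : 0 < (A + 5 * m₃) ^ 2 - 4 * A * m₃ := by nlinarith [sq_nonneg A, sq_nonneg m₃]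
  have hsq := Real.mul_self_sqrt hD.le
  have hspos := Real.sqrt_pos.mpr hD
  have hslt : √((A + 5 * m₃) ^ 2 - 4 * A * m₃) < A + 5 * m₃ :=
    (Real.sqrt_lt' (by positivity)).mpr (by linarith)
  generalize √((A + 5 * m₃) ^ 2 - 4 * A * m₃) = s at hsq hspos hslt
  refine ⟨fun θ h₀ h₁ => ?_, hD, by positivity, div_pos (by linarith) (by positivity), ?_, ?_⟩
  · rw [biharmonic_iff_quadratic A m₃ h₀ h₁,
      quadratic_eq_zero_iff hApos.ne' (s := s) (by rw [discrim, hsq]; ring), neg_neg]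
  · rw [Ne, div_left_inj' (by positivity)]
    linarith
  · intro θ h₀ h₁ h hharm
    rw [biharmonic_iff_quadratic A m₃ h₀ h₁, ← mul_assoc, hharm] at h
    have : m₃ * Real.cot θ ^ 2 = 0 := by linarith
    exact (mul_pos hm₃ (Real.cot_sq_pos_of_pos_of_lt_pi_div_two h₀ h₁)).ne' this
end

section
/- Let m₁, m₂, m₃ be positive real numbers and let θ ∈ (0, π/2). Then (2m₁+m₂+2m₃)·(1 − cot²θ) + (m₂+2m₃)·(1 − tan²θ) + 4(m₂+2m₃) = 0 holds if and only if cot²θ = (m₁+3(m₂+2m₃) ± √(m₁² + 4m₁(m₂+2m₃) + 8(m₂+2m₃)²))/(2m₁+m₂+2m₃) (for one of the two signs). The two values are positive and distinct, and no θ satisfying the equation satisfies (2m₁+m₂+2m₃)·cot²θ = m₂+2m₃. -/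
open Real

/-- On `(0, π/2)` the squares of the cotangent and the tangent are positive and mutually inverse. -/
lemma cot_sq_pos_and_cot_sq_mul_tan_sq {θ : ℝ} (h₀ : 0 < θ) (h₁ : θ < π / 2) :
    0 < Real.cot θ ^ 2 ∧ Real.cot θ ^ 2 * Real.tan θ ^ 2 = 1 := by
  have hs : 0 < Real.sin θ := Real.sin_pos_of_pos_of_lt_pi h₀ (by linarith [Real.pi_pos])
  have hc : 0 < Real.cos θ := Real.cos_pos_of_mem_Ioo ⟨by linarith [Real.pi_pos], h₁⟩
  rw [Real.cot_eq_cos_div_sin, Real.tan_eq_sin_div_cos]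
  exact ⟨by positivity, by field_simp⟩

/-- For `x * y = 1`, the equation `a(1 - x) + b(1 - y) + 4b = 0` is quadratic in `x`. -/
lemma linear_eq_zero_iff_quadratic_eq_zero {a b x y : ℝ} (hx : x ≠ 0) (hxy : x * y = 1) :
    a * (1 - x) + b * (1 - y) + 4 * b = 0 ↔ a * x ^ 2 - (a + 5 * b) * x + b = 0 := by
  have key : a * x ^ 2 - (a + 5 * b) * x + b =
      -x * (a * (1 - x) + b * (1 - y) + 4 * b) := by
    linear_combination -b * hxy
  rw [key, mul_eq_zero, neg_eq_zero, or_iff_right hx]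

/-- The roots of `(2m + b)x² - 2(m + 3b)x + b`. -/
lemma quadratic_eq_zero_iff_eq_div {m b x s : ℝ} (ha : 0 < 2 * m + b)
    (hs : s ^ 2 = m ^ 2 + 4 * m * b + 8 * b ^ 2) :
    (2 * m + b) * x ^ 2 - (2 * m + b + 5 * b) * x + b = 0 ↔
      x = (m + 3 * b + s) / (2 * m + b) ∨ x = (m + 3 * b - s) / (2 * m + b) := by
  have key : (2 * m + b) * ((2 * m + b) * x ^ 2 - (2 * m + b + 5 * b) * x + b) =
      (x * (2 * m + b) - (m + 3 * b + s)) * (x * (2 * m + b) - (m + 3 * b - s)) := by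
    linear_combination hs
  rw [eq_div_iff ha.ne', eq_div_iff ha.ne', ← sub_eq_zero (b := m + 3 * b + s),
    ← sub_eq_zero (b := m + 3 * b - s), ← mul_eq_zero, ← key, mul_eq_zero, or_iff_right ha.ne']

/-- Type BC₂ isotropy actions, edge `P₀^{α₂,δ}`: the biharmonicity condition
`(2m₁+m₂+2m₃)(1 − cot²θ) + (m₂+2m₃)(1 − tan²θ) + 4(m₂+2m₃) = 0` for `θ ∈ (0, π/2)`
holds iff `cot²θ = (m₁+3(m₂+2m₃) ± √(m₁² + 4m₁(m₂+2m₃) + 8(m₂+2m₃)²))/(2m₁+m₂+2m₃)`;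
the two values are positive and distinct, and no solution satisfies the harmonicity
condition `(2m₁+m₂+2m₃)cot²θ = m₂+2m₃`. -/
theorem stmt_7 (m₁ m₂ m₃ : ℝ) (hm₁ : 0 < m₁) (hm₂ : 0 < m₂) (hm₃ : 0 < m₃) :
    (∀ θ : ℝ, 0 < θ → θ < π / 2 →
      ((2 * m₁ + m₂ + 2 * m₃) * (1 - Real.cot θ ^ 2) +
          (m₂ + 2 * m₃) * (1 - Real.tan θ ^ 2) + 4 * (m₂ + 2 * m₃) = 0 ↔
        Real.cot θ ^ 2 =
          (m₁ + 3 * (m₂ + 2 * m₃) +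
            Real.sqrt (m₁ ^ 2 + 4 * m₁ * (m₂ + 2 * m₃) + 8 * (m₂ + 2 * m₃) ^ 2)) /
            (2 * m₁ + m₂ + 2 * m₃) ∨
        Real.cot θ ^ 2 =
          (m₁ + 3 * (m₂ + 2 * m₃) -
            Real.sqrt (m₁ ^ 2 + 4 * m₁ * (m₂ + 2 * m₃) + 8 * (m₂ + 2 * m₃) ^ 2)) /
            (2 * m₁ + m₂ + 2 * m₃))) ∧
    0 < (m₁ + 3 * (m₂ + 2 * m₃) +
          Real.sqrt (m₁ ^ 2 + 4 * m₁ * (m₂ + 2 * m₃) + 8 * (m₂ + 2 * m₃) ^ 2)) /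
          (2 * m₁ + m₂ + 2 * m₃) ∧
    0 < (m₁ + 3 * (m₂ + 2 * m₃) -
          Real.sqrt (m₁ ^ 2 + 4 * m₁ * (m₂ + 2 * m₃) + 8 * (m₂ + 2 * m₃) ^ 2)) /
          (2 * m₁ + m₂ + 2 * m₃) ∧
    (m₁ + 3 * (m₂ + 2 * m₃) +
        Real.sqrt (m₁ ^ 2 + 4 * m₁ * (m₂ + 2 * m₃) + 8 * (m₂ + 2 * m₃) ^ 2)) /
        (2 * m₁ + m₂ + 2 * m₃) ≠
      (m₁ + 3 * (m₂ + 2 * m₃) -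
        Real.sqrt (m₁ ^ 2 + 4 * m₁ * (m₂ + 2 * m₃) + 8 * (m₂ + 2 * m₃) ^ 2)) /
        (2 * m₁ + m₂ + 2 * m₃) ∧
    (∀ θ : ℝ, 0 < θ → θ < π / 2 →
      (2 * m₁ + m₂ + 2 * m₃) * (1 - Real.cot θ ^ 2) +
        (m₂ + 2 * m₃) * (1 - Real.tan θ ^ 2) + 4 * (m₂ + 2 * m₃) = 0 →
      (2 * m₁ + m₂ + 2 * m₃) * Real.cot θ ^ 2 ≠ m₂ + 2 * m₃) := by
  have hb : 0 < m₂ + 2 * m₃ := by positivity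
  rw [add_assoc (2 * m₁) m₂ (2 * m₃)]
  generalize m₂ + 2 * m₃ = b at hb ⊢
  have ha : 0 < 2 * m₁ + b := by positivity
  have hd : 0 < m₁ ^ 2 + 4 * m₁ * b + 8 * b ^ 2 := by positivity
  have hs := Real.sqrt_pos.2 hd
  have hs2 := Real.sq_sqrt hd.le
  generalize √(m₁ ^ 2 + 4 * m₁ * b + 8 * b ^ 2) = s at hs hs2 ⊢
  have hlt : s < m₁ + 3 * b :=
    lt_of_pow_lt_pow_left₀ 2 (by positivity) (by nlinarith [mul_pos hm₁ hb, mul_pos hb hb])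
  refine ⟨fun θ h₀ h₁ => ?_, by positivity, div_pos (sub_pos.2 hlt) ha, fun h => ?_,
    fun θ h₀ h₁ h hx => ?_⟩
  · obtain ⟨hx, hxy⟩ := cot_sq_pos_and_cot_sq_mul_tan_sq h₀ h₁
    rw [linear_eq_zero_iff_quadratic_eq_zero hx.ne' hxy, quadratic_eq_zero_iff_eq_div ha hs2]
  · rw [div_left_inj' ha.ne'] at h
    linarith
  · obtain ⟨hpos, hxy⟩ := cot_sq_pos_and_cot_sq_mul_tan_sq h₀ h₁
    rw [linear_eq_zero_iff_quadratic_eq_zero hpos.ne' hxy] at h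
    have h4 : 4 * b * Real.cot θ ^ 2 = 0 := by
      linear_combination -h + (Real.cot θ ^ 2 - 1) * hx
    exact (by positivity : 4 * b * Real.cot θ ^ 2 ≠ 0) h4
end

section
/- Let m₁, m₂, m₃ be positive real numbers and let θ ∈ (0, π/2). Then (2m₂+m₃)·(1 − cot²θ) + (m₁+m₃)·(1 − tan²θ) + 4m₃ = 0 holds if and only if cot²θ = (m₁+2m₂+6m₃ ± √((m₁−2m₂)² + 8m₃(m₁+2m₂+4m₃)))/(2(2m₂+m₃)) (for one of the two signs). The discriminant (m₁−2m₂)² + 8m₃(m₁+2m₂+4m₃) is positive, the two values are positive and distinct, and no θ satisfying the equation satisfies (2m₂+m₃)·cot²θ = m₁+m₃. -/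
open Real

/-- On `(0, π/2)` the squared tangent is the inverse of the positive squared cotangent. -/
lemma cot_sq_pos_and_tan_sq_eq_inv {θ : ℝ} (h₀ : 0 < θ) (h₁ : θ < π / 2) :
    0 < Real.cot θ ^ 2 ∧ Real.tan θ ^ 2 = (Real.cot θ ^ 2)⁻¹ := by
  have ht : 0 < Real.tan θ := Real.tan_pos_of_pos_of_lt_pi_div_two h₀ h₁
  have hc : Real.cot θ = (Real.tan θ)⁻¹ := by
    rw [Real.cot_eq_cos_div_sin, Real.tan_eq_sin_div_cos, inv_div]
  rw [hc]
  exact ⟨by positivity, by rw [inv_pow, inv_inv]⟩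

/-- Type BC₂ isotropy actions, edge `P₀^{α₁,α₂}`: the biharmonicity condition
`(2m₂+m₃)(1 − cot²θ) + (m₁+m₃)(1 − tan²θ) + 4m₃ = 0` for `θ ∈ (0, π/2)` holds iff
`cot²θ = (m₁+2m₂+6m₃ ± √((m₁−2m₂)² + 8m₃(m₁+2m₂+4m₃)))/(2(2m₂+m₃))`; the discriminant
is positive, the two values are positive and distinct, and no solution satisfies the
harmonicity condition `(2m₂+m₃)cot²θ = m₁+m₃`. -/
theorem stmt_8 (m₁ m₂ m₃ : ℝ) (hm₁ : 0 < m₁) (hm₂ : 0 < m₂) (hm₃ : 0 < m₃) :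
    (∀ θ : ℝ, 0 < θ → θ < π / 2 →
      ((2 * m₂ + m₃) * (1 - Real.cot θ ^ 2) + (m₁ + m₃) * (1 - Real.tan θ ^ 2)
          + 4 * m₃ = 0 ↔
        Real.cot θ ^ 2 =
          (m₁ + 2 * m₂ + 6 * m₃ +
            Real.sqrt ((m₁ - 2 * m₂) ^ 2 + 8 * m₃ * (m₁ + 2 * m₂ + 4 * m₃))) /
            (2 * (2 * m₂ + m₃)) ∨
        Real.cot θ ^ 2 =
          (m₁ + 2 * m₂ + 6 * m₃ -
            Real.sqrt ((m₁ - 2 * m₂) ^ 2 + 8 * m₃ * (m₁ + 2 * m₂ + 4 * m₃))) /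
            (2 * (2 * m₂ + m₃)))) ∧
    0 < (m₁ - 2 * m₂) ^ 2 + 8 * m₃ * (m₁ + 2 * m₂ + 4 * m₃) ∧
    0 < (m₁ + 2 * m₂ + 6 * m₃ +
          Real.sqrt ((m₁ - 2 * m₂) ^ 2 + 8 * m₃ * (m₁ + 2 * m₂ + 4 * m₃))) /
          (2 * (2 * m₂ + m₃)) ∧
    0 < (m₁ + 2 * m₂ + 6 * m₃ -
          Real.sqrt ((m₁ - 2 * m₂) ^ 2 + 8 * m₃ * (m₁ + 2 * m₂ + 4 * m₃))) /
          (2 * (2 * m₂ + m₃)) ∧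
    (m₁ + 2 * m₂ + 6 * m₃ +
        Real.sqrt ((m₁ - 2 * m₂) ^ 2 + 8 * m₃ * (m₁ + 2 * m₂ + 4 * m₃))) /
        (2 * (2 * m₂ + m₃)) ≠
      (m₁ + 2 * m₂ + 6 * m₃ -
        Real.sqrt ((m₁ - 2 * m₂) ^ 2 + 8 * m₃ * (m₁ + 2 * m₂ + 4 * m₃))) /
        (2 * (2 * m₂ + m₃)) ∧
    (∀ θ : ℝ, 0 < θ → θ < π / 2 →
      (2 * m₂ + m₃) * (1 - Real.cot θ ^ 2) + (m₁ + m₃) * (1 - Real.tan θ ^ 2)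
        + 4 * m₃ = 0 →
      (2 * m₂ + m₃) * Real.cot θ ^ 2 ≠ m₁ + m₃) := by
  have hA : 0 < 2 * m₂ + m₃ := by positivity
  have hD : 0 < (m₁ - 2 * m₂) ^ 2 + 8 * m₃ * (m₁ + 2 * m₂ + 4 * m₃) := by positivity
  set s := Real.sqrt ((m₁ - 2 * m₂) ^ 2 + 8 * m₃ * (m₁ + 2 * m₂ + 4 * m₃))
  have hs₀ : 0 < s := Real.sqrt_pos.2 hD
  have hs_sq : s ^ 2 = (m₁ - 2 * m₂) ^ 2 + 8 * m₃ * (m₁ + 2 * m₂ + 4 * m₃) :=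
    Real.sq_sqrt hD.le
  have hs_lt : s < m₁ + 2 * m₂ + 6 * m₃ := by
    refine lt_of_pow_lt_pow_left₀ 2 (by positivity) ?_
    have : 0 < (2 * m₂ + m₃) * (m₁ + m₃) := by positivity
    nlinarith
  refine ⟨fun θ h₀ h₁ => ?_, hD, by positivity, div_pos (sub_pos.2 hs_lt) (by positivity),
    fun h => ?_, fun θ h₀ h₁ h hharm => ?_⟩
  · obtain ⟨hx, ht⟩ := cot_sq_pos_and_tan_sq_eq_inv h₀ h₁
    rw [ht]
    generalize Real.cot θ ^ 2 = x at hx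
    have hquad := quadratic_eq_zero_iff (a := 2 * m₂ + m₃) (b := -(m₁ + 2 * m₂ + 6 * m₃))
      (c := m₁ + m₃) (s := s) hA.ne' (by rw [discrim]; linear_combination -hs_sq) x
    rw [neg_neg] at hquad
    rw [← hquad]
    have key : (2 * m₂ + m₃) * (x * x) + -(m₁ + 2 * m₂ + 6 * m₃) * x + (m₁ + m₃) =
        -x * ((2 * m₂ + m₃) * (1 - x) + (m₁ + m₃) * (1 - x⁻¹) + 4 * m₃) := by
      field_simp
      ring
    rw [key, mul_eq_zero, or_iff_right (neg_ne_zero.2 hx.ne')]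
  · rw [div_left_inj' (by positivity)] at h
    linarith
  · obtain ⟨hx, ht⟩ := cot_sq_pos_and_tan_sq_eq_inv h₀ h₁
    rw [ht, ← hharm] at h
    have hm₃_zero : 4 * m₃ = 0 := by
      linear_combination h + (2 * m₂ + m₃) * mul_inv_cancel₀ hx.ne'
    linarith
end

section
/- For every real θ with 0 < θ < π/3, one has cot θ + cot(2θ) ≠ 0, and the equality cot θ + cot(2θ) + 3·(cot θ · cot(2θ) − 1)/(cot θ + cot(2θ)) = 0 holds if and only if cot²θ = (12 + √129)/15. -/
open Real

/-- Both sides vanish when `cos θ = 0`, so only `sin θ ≠ 0` is needed. -/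
theorem Real.cot_two_mul_of_sin_ne_zero {θ : ℝ} (hs : sin θ ≠ 0) :
    Real.cot (2 * θ) = (Real.cot θ ^ 2 - 1) / (2 * Real.cot θ) := by
  rw [Real.cot_eq_cos_div_sin, Real.cot_eq_cos_div_sin, sin_two_mul, cos_two_mul']
  by_cases hc : cos θ = 0
  · simp [hc]
  · field_simp

theorem Real.one_half_lt_cos {θ : ℝ} (h0 : 0 ≤ θ) (h1 : θ < π / 3) : 1 / 2 < cos θ := by
  rw [← cos_pi_div_three]
  exact cos_lt_cos_of_nonneg_of_le_pi h0 (by linarith [pi_pos]) h1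

theorem Real.one_third_lt_cot_sq {θ : ℝ} (h0 : 0 < θ) (h1 : θ < π / 3) :
    1 / 3 < Real.cot θ ^ 2 := by
  have hs : 0 < sin θ := sin_pos_of_pos_of_lt_pi h0 (by linarith [pi_pos])
  have hc := Real.one_half_lt_cos h0.le h1
  rw [Real.cot_eq_cos_div_sin, div_pow, lt_div_iff₀ (by positivity)]
  nlinarith [sin_sq_add_cos_sq θ]

theorem quadratic_eq_zero_iff_of_one_third_lt {t : ℝ} (ht : 1 / 3 < t) :
    15 * t ^ 2 - 24 * t + 1 = 0 ↔ t = (12 + √129) / 15 := by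
  have hsq : √129 ^ 2 = (129 : ℝ) := sq_sqrt (by norm_num)
  have hlt : (7 : ℝ) < √129 := lt_sqrt_of_sq_lt (by norm_num)
  constructor
  · intro h
    have hprod : (15 * t - 12 - √129) * (15 * t - 12 + √129) = 0 := by
      linear_combination 15 * h - hsq
    rcases mul_eq_zero.mp hprod with h | h <;> linarith
  · rintro rfl
    linear_combination hsq / 15

/-- Type G₂, edge `P₀^{α₁,δ}`, harmonicity computation: for `θ ∈ (0, π/3)` one has
`cot θ + cot 2θ ≠ 0`, and the tension field coefficient
`cot θ + cot 2θ + 3(cot θ · cot 2θ − 1)/(cot θ + cot 2θ)` vanishes iff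
`cot²θ = (12 + √129)/15`. -/
theorem stmt_13 (θ : ℝ) (h0 : 0 < θ) (h1 : θ < π / 3) :
    Real.cot θ + Real.cot (2 * θ) ≠ 0 ∧
    (Real.cot θ + Real.cot (2 * θ) +
        3 * (Real.cot θ * Real.cot (2 * θ) - 1) / (Real.cot θ + Real.cot (2 * θ)) = 0 ↔
      Real.cot θ ^ 2 = (12 + Real.sqrt 129) / 15) := by
  have hs : sin θ ≠ 0 := (sin_pos_of_pos_of_lt_pi h0 (by linarith [pi_pos])).ne'
  have ht := Real.one_third_lt_cot_sq h0 h1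
  rw [Real.cot_two_mul_of_sin_ne_zero hs]
  generalize Real.cot θ = x at ht
  have hx : x ≠ 0 := by
    rintro rfl
    norm_num at ht
  have hn : 3 * x ^ 2 - 1 ≠ 0 := by linarith
  have hsum : x + (x ^ 2 - 1) / (2 * x) = (3 * x ^ 2 - 1) / (2 * x) := by
    field_simp
    ring
  have hcoeff : (3 * x ^ 2 - 1) / (2 * x) +
      3 * (x * ((x ^ 2 - 1) / (2 * x)) - 1) / ((3 * x ^ 2 - 1) / (2 * x)) =
        (15 * (x ^ 2) ^ 2 - 24 * x ^ 2 + 1) / (2 * x * (3 * x ^ 2 - 1)) := by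
    field_simp
    ring
  have hden : 2 * x * (3 * x ^ 2 - 1) ≠ 0 := by positivity
  rw [hsum, hcoeff, ← quadratic_eq_zero_iff_of_one_third_lt ht, div_eq_zero_iff,
    or_iff_left hden]
  exact ⟨div_ne_zero hn (by positivity), Iff.rfl⟩
end

section
/- Let m₁, m₂, m₃, n₁ be positive real numbers, and set l₁ = m₁+2m₂+m₃, l₂ = n₁+m₃. Then the quadratic equation l₁·v² − (l₁+l₂+4m₃)·v + l₂ = 0 has exactly two real roots v₋ < v₊; both roots are positive, and l₂/l₁ lies strictly between them: v₋ < l₂/l₁ < v₊. -/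
/-- A real quadratic `a v² - b v + c` with positive `a`, `b`, `c` which is negative at `r` has
exactly two real roots; they are positive and lie on either side of `r`. -/
theorem exists_pos_roots_of_quadratic_neg {a b c r : ℝ} (ha : 0 < a) (hb : 0 < b) (hc : 0 < c)
    (hr : a * r ^ 2 - b * r + c < 0) :
    ∃ x y : ℝ, x < y ∧ {v : ℝ | a * v ^ 2 - b * v + c = 0} = {x, y} ∧
      0 < x ∧ x < r ∧ r < y := by
  have hdisc : (2 * a * r - b) ^ 2 < b ^ 2 - 4 * a * c := by
    linear_combination (4 * a) * hr
  have hsqrt : √(b ^ 2 - 4 * a * c) ^ 2 = b ^ 2 - 4 * a * c :=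
    Real.sq_sqrt ((sq_nonneg _).trans hdisc.le)
  obtain ⟨hlow, hupp⟩ := abs_lt.mp (Real.lt_sqrt_of_sq_lt (by rwa [sq_abs]))
  have hsb : √(b ^ 2 - 4 * a * c) < b := by
    rw [Real.sqrt_lt' hb]
    linarith [mul_pos ha hc]
  set s := √(b ^ 2 - 4 * a * c)
  have hxr : (b - s) / (2 * a) < r := by
    rw [div_lt_iff₀ (by positivity)]
    linarith
  have hry : r < (b + s) / (2 * a) := by
    rw [lt_div_iff₀ (by positivity)]
    linarith
  refine ⟨(b - s) / (2 * a), (b + s) / (2 * a), hxr.trans hry, ?_,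
    div_pos (sub_pos.mpr hsb) (by positivity), hxr, hry⟩
  ext v
  have hfactor : a * v ^ 2 - b * v + c =
      a * ((v - (b - s) / (2 * a)) * (v - (b + s) / (2 * a))) := by
    field_simp
    linear_combination hsqrt
  simp only [Set.mem_ofPred_eq, Set.mem_insert_iff, Set.mem_singleton_iff]
  rw [hfactor, mul_eq_zero, mul_eq_zero, sub_eq_zero, sub_eq_zero]
  simp [ha.ne']

/-- Type I-B₂ / I-BC₂-A₁², edge `P₀^{α₁,α̃}`: with `l₁ = m₁+2m₂+m₃` and `l₂ = n₁+m₃`,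
the biharmonic equation `l₁v² − (l₁+l₂+4m₃)v + l₂ = 0` has exactly two real roots
`v₋ < v₊`; both are positive and the harmonicity value `l₂/l₁` lies strictly between
them. -/
theorem stmt_14 (m₁ m₂ m₃ n₁ l₁ l₂ : ℝ)
    (hm₁ : 0 < m₁) (hm₂ : 0 < m₂) (hm₃ : 0 < m₃) (hn₁ : 0 < n₁)
    (hl₁ : l₁ = m₁ + 2 * m₂ + m₃) (hl₂ : l₂ = n₁ + m₃) :
    ∃ vm vp : ℝ, vm < vp ∧
      {v : ℝ | l₁ * v ^ 2 - (l₁ + l₂ + 4 * m₃) * v + l₂ = 0} = {vm, vp} ∧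
      0 < vm ∧ vm < l₂ / l₁ ∧ l₂ / l₁ < vp := by
  have h₁ : 0 < l₁ := by rw [hl₁]; positivity
  have h₂ : 0 < l₂ := by rw [hl₂]; positivity
  refine exists_pos_roots_of_quadratic_neg h₁ (by positivity) h₂ ?_
  have hval : l₁ * (l₂ / l₁) ^ 2 - (l₁ + l₂ + 4 * m₃) * (l₂ / l₁) + l₂ =
      -(4 * m₃ * (l₂ / l₁)) := by
    field_simp
    ring
  rw [hval, neg_lt_zero]
  positivity
end

section
/- Let m₁, m₂ be positive real numbers and let θ ∈ (0, π). Then m₁·(3/2 − cot²(θ/2)) + 4m₂·(3/2 − cot²θ) = 0 holds if and only if cot²(θ/2) = (3m₁+16m₂ + √(9m₁² + 80m₁m₂ + 240m₂²))/(4(m₁+m₂)) or cot²(θ/2) = (3m₁+16m₂ − √(9m₁² + 80m₁m₂ + 240m₂²))/(4(m₁+m₂)). Both of these values are positive and distinct, and no θ satisfying the equation satisfies (m₁+m₂)·cot²(θ/2) = m₂. -/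
open Real

/-- The half-angle formula for the square of the cotangent. -/
lemma cot_sq_eq_half_angle {θ : ℝ} (h0 : 0 < θ) (hπ : θ < π) :
    0 < Real.cot (θ / 2) ^ 2 ∧
      Real.cot θ ^ 2 = (Real.cot (θ / 2) ^ 2 - 1) ^ 2 / (4 * Real.cot (θ / 2) ^ 2) := by
  have hs : 0 < sin (θ / 2) := sin_pos_of_pos_of_lt_pi (by linarith) (by linarith)
  have hc : 0 < cos (θ / 2) := cos_pos_of_mem_Ioo ⟨by linarith, by linarith⟩
  have hsin : sin θ = 2 * sin (θ / 2) * cos (θ / 2) := by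
    rw [← sin_two_mul, mul_div_cancel₀ θ two_ne_zero]
  have hcos : cos θ = cos (θ / 2) ^ 2 - sin (θ / 2) ^ 2 := by
    rw [← cos_two_mul', mul_div_cancel₀ θ two_ne_zero]
  rw [Real.cot_eq_cos_div_sin, Real.cot_eq_cos_div_sin, hsin, hcos]
  refine ⟨by positivity, ?_⟩
  field_simp
  ring

/-- The biharmonicity condition as a quadratic equation in `cot² (θ / 2)`. -/
lemma biharmonic_iff_quadratic_s18 (m₁ m₂ : ℝ) {θ : ℝ} (h0 : 0 < θ) (hπ : θ < π) :
    m₁ * (3 / 2 - Real.cot (θ / 2) ^ 2) + 4 * m₂ * (3 / 2 - Real.cot θ ^ 2) = 0 ↔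
      2 * (m₁ + m₂) * (Real.cot (θ / 2) ^ 2) ^ 2
        - (3 * m₁ + 16 * m₂) * Real.cot (θ / 2) ^ 2 + 2 * m₂ = 0 := by
  obtain ⟨hx, hcot⟩ := cot_sq_eq_half_angle h0 hπ
  rw [hcot]
  generalize Real.cot (θ / 2) ^ 2 = x at hx
  have key : 2 * (m₁ + m₂) * x ^ 2 - (3 * m₁ + 16 * m₂) * x + 2 * m₂ =
      -(2 * x) * (m₁ * (3 / 2 - x) + 4 * m₂ * (3 / 2 - (x - 1) ^ 2 / (4 * x))) := by
    field_simp
    ring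
  rw [key, mul_eq_zero, or_iff_right (by linarith)]

/-- Type BC₁ rank-one case: for `θ ∈ (0, π)`, the biharmonicity condition
`m₁(3/2 − cot²(θ/2)) + 4m₂(3/2 − cot²θ) = 0` holds iff
`cot²(θ/2) = (3m₁+16m₂ ± √(9m₁² + 80m₁m₂ + 240m₂²))/(4(m₁+m₂))`; both values are
positive and distinct, and no solution satisfies the harmonicity condition
`(m₁+m₂)cot²(θ/2) = m₂`. -/
theorem stmt_18 (m₁ m₂ : ℝ) (hm₁ : 0 < m₁) (hm₂ : 0 < m₂) :
    (∀ θ : ℝ, 0 < θ → θ < π →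
      (m₁ * (3 / 2 - Real.cot (θ / 2) ^ 2) + 4 * m₂ * (3 / 2 - Real.cot θ ^ 2) = 0 ↔
        Real.cot (θ / 2) ^ 2 =
          (3 * m₁ + 16 * m₂ +
            Real.sqrt (9 * m₁ ^ 2 + 80 * m₁ * m₂ + 240 * m₂ ^ 2)) / (4 * (m₁ + m₂)) ∨
        Real.cot (θ / 2) ^ 2 =
          (3 * m₁ + 16 * m₂ -
            Real.sqrt (9 * m₁ ^ 2 + 80 * m₁ * m₂ + 240 * m₂ ^ 2)) / (4 * (m₁ + m₂)))) ∧
    0 < (3 * m₁ + 16 * m₂ +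
          Real.sqrt (9 * m₁ ^ 2 + 80 * m₁ * m₂ + 240 * m₂ ^ 2)) / (4 * (m₁ + m₂)) ∧
    0 < (3 * m₁ + 16 * m₂ -
          Real.sqrt (9 * m₁ ^ 2 + 80 * m₁ * m₂ + 240 * m₂ ^ 2)) / (4 * (m₁ + m₂)) ∧
    (3 * m₁ + 16 * m₂ +
        Real.sqrt (9 * m₁ ^ 2 + 80 * m₁ * m₂ + 240 * m₂ ^ 2)) / (4 * (m₁ + m₂)) ≠
      (3 * m₁ + 16 * m₂ -
        Real.sqrt (9 * m₁ ^ 2 + 80 * m₁ * m₂ + 240 * m₂ ^ 2)) / (4 * (m₁ + m₂)) ∧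
    (∀ θ : ℝ, 0 < θ → θ < π →
      m₁ * (3 / 2 - Real.cot (θ / 2) ^ 2) + 4 * m₂ * (3 / 2 - Real.cot θ ^ 2) = 0 →
      (m₁ + m₂) * Real.cot (θ / 2) ^ 2 ≠ m₂) := by
  have hs : 0 < 4 * (m₁ + m₂) := by positivity
  have hD : 0 < 9 * m₁ ^ 2 + 80 * m₁ * m₂ + 240 * m₂ ^ 2 := by positivity
  have hr := Real.sqrt_pos.2 hD
  have hr2 := Real.sq_sqrt hD.le
  generalize Real.sqrt (9 * m₁ ^ 2 + 80 * m₁ * m₂ + 240 * m₂ ^ 2) = r at hr hr2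
  have hlt : r < 3 * m₁ + 16 * m₂ := by
    refine lt_of_pow_lt_pow_left₀ 2 (by positivity) ?_
    nlinarith [mul_pos hm₁ hm₂, mul_pos hm₂ hm₂]
  refine ⟨fun θ h0 hπ => ?_, by positivity, div_pos (by linarith) hs, fun h => ?_,
    fun θ h0 hπ h hx => ?_⟩
  · rw [biharmonic_iff_quadratic_s18 m₁ m₂ h0 hπ, eq_div_iff hs.ne', eq_div_iff hs.ne']
    generalize Real.cot (θ / 2) ^ 2 = x
    have key : (x * (4 * (m₁ + m₂)) - (3 * m₁ + 16 * m₂ + r)) *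
        (x * (4 * (m₁ + m₂)) - (3 * m₁ + 16 * m₂ - r)) =
        2 * (4 * (m₁ + m₂)) *
          (2 * (m₁ + m₂) * x ^ 2 - (3 * m₁ + 16 * m₂) * x + 2 * m₂) := by
      linear_combination -hr2
    rw [← sub_eq_zero (b := 3 * m₁ + 16 * m₂ + r), ← sub_eq_zero (b := 3 * m₁ + 16 * m₂ - r),
      ← mul_eq_zero, key, mul_eq_zero, or_iff_right (by linarith)]
  · rw [div_left_inj' hs.ne'] at h
    linarith
  · rw [biharmonic_iff_quadratic_s18 m₁ m₂ h0 hπ] at h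
    generalize Real.cot (θ / 2) ^ 2 = x at h hx
    have : m₂ * (m₁ + 12 * m₂) = 0 := by
      linear_combination (2 * (m₁ + m₂) * x + 2 * m₂ - (3 * m₁ + 16 * m₂)) * hx - (m₁ + m₂) * h
    have : 0 < m₂ * (m₁ + 12 * m₂) := by positivity
    linarith
end
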